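/- arXiv:2310.05698 — 2 statements merged into one kernel-verified Lean document; each statement's English description precedes it below -/
import Mathlib

section
/- Let Λ^k ∈ ℝ^{H×D} stack the honest dual iterates (λ_i^k)_{i∈𝓗} and Λ^{k+1/2} stack the half-step iterates λ_i^{k+1/2} = λ_i^k − γ^k(s/J − θ_i^k/J). If the step size satisfies γ^k ≤ u_f·J/(2√3), then ‖Λ^{k+1/2} − (1/H)11ᵀΛ^{k+1/2}‖_F² ≤ 3·‖Λ^k − (1/H)11ᵀΛ^k‖_F² + 6(γ^k)²δ²H³/J². -/
open Filter Finset
open scoped BigOperators Topology InnerProductSpace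

section DualConsensus

variable {E : Type*} [NormedAddCommGroup E] [InnerProductSpace ℝ E]

/-- The mean minimizes the sum of squared distances to finitely many points. -/
theorem sum_norm_sub_mean_sq_le {ι : Type*} [Fintype ι] (x : ι → E) (c : E) :
    ∑ i, ‖x i - (Fintype.card ι : ℝ)⁻¹ • ∑ j, x j‖ ^ 2 ≤ ∑ i, ‖x i - c‖ ^ 2 := by
  cases isEmpty_or_nonempty ι
  · simp
  set m := (Fintype.card ι : ℝ)⁻¹ • ∑ j, x j with hm
  have hcard : (Fintype.card ι : ℝ) ≠ 0 := by exact_mod_cast Fintype.card_ne_zero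
  have hsum : ∑ i, (x i - m) = 0 := by
    rw [Finset.sum_sub_distrib, Finset.sum_const, Finset.card_univ, ← Nat.cast_smul_eq_nsmul ℝ,
      hm, smul_inv_smul₀ hcard, sub_self]
  have hinner : ∑ i, ⟪x i - m, m - c⟫_ℝ = 0 := by
    rw [← sum_inner, hsum, inner_zero_left]
  have hexp : ∀ i, ‖x i - c‖ ^ 2 =
      ‖x i - m‖ ^ 2 + 2 * ⟪x i - m, m - c⟫_ℝ + ‖m - c‖ ^ 2 := fun i ↦ by
    rw [← norm_add_sq_real, sub_add_sub_cancel]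
  simp only [hexp, Finset.sum_add_distrib, ← Finset.mul_sum, hinner]
  have : 0 ≤ ∑ _i : ι, ‖m - c‖ ^ 2 := Finset.sum_nonneg fun _ _ ↦ sq_nonneg _
  linarith

/-- Quadratic growth of a linearly perturbed strongly convex function at a constrained minimizer. -/
theorem StrongConvexOn.quadratic_growth_of_isMin {m : ℝ} (hm : 0 ≤ m) {s C : Set E} {f : E → ℝ}
    (hf : StrongConvexOn s m f) (hCs : C ⊆ s) (hC : Convex ℝ C) {l p q : E}
    (hp : p ∈ C) (hq : q ∈ C)
    (hmin : ∀ θ ∈ C, ⟪l, p⟫_ℝ + f p ≤ ⟪l, θ⟫_ℝ + f θ) :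
    ⟪l, p⟫_ℝ + f p + m / 2 * ‖p - q‖ ^ 2 ≤ ⟪l, q⟫_ℝ + f q := by
  set K := m / 2 * ‖p - q‖ ^ 2 with hK
  have hK0 : 0 ≤ K := by positivity
  have key : ∀ t : ℝ, 0 < t → t < 1 →
      (1 - t) * K ≤ ⟪l, q⟫_ℝ + f q - (⟪l, p⟫_ℝ + f p) := by
    intro t ht0 ht1
    have h1 := hmin _ (hC hp hq (sub_nonneg.2 ht1.le) ht0.le (by ring))
    have h2 := hf.2 (hCs hp) (hCs hq) (sub_nonneg.2 ht1.le) ht0.le (by ring)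
    simp only [inner_add_right, inner_smul_right, smul_eq_mul] at h1 h2
    refine le_of_mul_le_mul_left ?_ ht0
    rw [hK]
    linarith
  have hlim : Tendsto (fun t : ℝ ↦ (1 - t) * K) (𝓝[>] 0) (𝓝 K) := by
    have : Continuous fun t : ℝ ↦ (1 - t) * K := by fun_prop
    simpa using (this.tendsto 0).mono_left nhdsWithin_le_nhds
  have := le_of_tendsto hlim (Filter.mem_of_superset (Ioo_mem_nhdsGT one_pos)
    fun t ht ↦ key t ht.1 ht.2)
  linarith

/-- The constrained minimizer of a linearly perturbed `m`-strongly convex function is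
`1 / m`-Lipschitz in the linear perturbation. -/
theorem StrongConvexOn.mul_norm_sub_le_of_isMin {m : ℝ} (hm : 0 ≤ m) {s C : Set E} {f : E → ℝ}
    (hf : StrongConvexOn s m f) (hCs : C ⊆ s) (hC : Convex ℝ C) {l l' p q : E}
    (hp : p ∈ C) (hq : q ∈ C)
    (hpmin : ∀ θ ∈ C, ⟪l, p⟫_ℝ + f p ≤ ⟪l, θ⟫_ℝ + f θ)
    (hqmin : ∀ θ ∈ C, ⟪l', q⟫_ℝ + f q ≤ ⟪l', θ⟫_ℝ + f θ) :
    m * ‖p - q‖ ≤ ‖l - l'‖ := by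
  have h1 := hf.quadratic_growth_of_isMin hm hCs hC hp hq hpmin
  have h2 := hf.quadratic_growth_of_isMin hm hCs hC hq hp hqmin
  rw [norm_sub_rev q p] at h2
  have h3 := real_inner_le_norm (l - l') (q - p)
  rw [norm_sub_rev q p] at h3
  simp only [inner_sub_left, inner_sub_right] at h3
  rcases (norm_nonneg (p - q)).eq_or_lt with h0 | h0
  · rw [← h0, mul_zero]
    exact norm_nonneg _
  · refine le_of_mul_le_mul_right ?_ h0
    linarith

theorem norm_add_add_sq_le_of_norm_sq_le {F : Type*} [SeminormedAddCommGroup F] {a b c : F}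
    (hb : 12 * ‖b‖ ^ 2 ≤ ‖a‖ ^ 2) :
    ‖a + b + c‖ ^ 2 ≤ 3 * ‖a‖ ^ 2 + 6 * ‖c‖ ^ 2 := by
  have h : ‖a + b + c‖ ^ 2 ≤ (‖a‖ + ‖b‖ + ‖c‖) ^ 2 := by
    gcongr
    exact norm_add₃_le
  nlinarith [sq_nonneg (‖a‖ - ‖b‖), sq_nonneg (‖a‖ + ‖b‖ - 5 * ‖c‖)]

end DualConsensus

theorem statement_8
    (D H J : ℕ) (hH : 0 < H) (hHJ : H ≤ J)
    (uf Lf : ℝ) (huf : 0 < uf) (hufLf : uf ≤ Lf)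
    (f : Fin H → EuclideanSpace ℝ (Fin D) → ℝ)
    (C : Fin H → Set (EuclideanSpace ℝ (Fin D)))
    (hCne : ∀ i, (C i).Nonempty)
    (hCcpt : ∀ i, IsCompact (C i))
    (hCcvx : ∀ i, Convex ℝ (C i))
    (hfsc : ∀ i, StrongConvexOn Set.univ uf (f i))
    (hfdiff : ∀ i, Differentiable ℝ (f i))
    (hfsm : ∀ i x y, ‖gradient (f i) x - gradient (f i) y‖ ≤ Lf * ‖x - y‖)
    (s : EuclideanSpace ℝ (Fin D))
    -- `prox i lam` is the minimizer of `θ ↦ ⟪lam, θ⟫ + f i θ` over `C i`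
    (prox : Fin H → EuclideanSpace ℝ (Fin D) → EuclideanSpace ℝ (Fin D))
    (hprox : ∀ i lam, prox i lam ∈ C i ∧
      ∀ θ ∈ C i, ⟪lam, prox i lam⟫_ℝ + f i (prox i lam) ≤ ⟪lam, θ⟫_ℝ + f i θ)
    -- gradients of the local dual functions
    (gradg : Fin H → EuclideanSpace ℝ (Fin D) → EuclideanSpace ℝ (Fin D))
    (hgradg : ∀ i lam, gradg i lam = (H : ℝ)⁻¹ • s - (H : ℝ)⁻¹ • prox i lam)
    -- uniform bound on the deviation of the local dual gradients
    (δ : ℝ) (hδ0 : 0 ≤ δ)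
    (hδ : ∀ (lam : EuclideanSpace ℝ (Fin D)) (i : Fin H),
      ‖gradg i lam - (H : ℝ)⁻¹ • ∑ j, gradg j lam‖ ^ 2 ≤ δ ^ 2)
    -- one step of the algorithm: current iterates and half-step iterates
    (γ : ℝ) (hγ : 0 < γ)
    (lam lamh θv : Fin H → EuclideanSpace ℝ (Fin D))
    (hθ : ∀ i, θv i = prox i (lam i))
    (hhalf : ∀ i, lamh i = lam i - γ • ((J : ℝ)⁻¹ • s - (J : ℝ)⁻¹ • θv i))
    (hγle : γ ≤ uf * (J : ℝ) / (2 * Real.sqrt 3)) :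
    ∑ i, ‖lamh i - (H : ℝ)⁻¹ • ∑ j, lamh j‖ ^ 2 ≤
      3 * ∑ i, ‖lam i - (H : ℝ)⁻¹ • ∑ j, lam j‖ ^ 2 +
        6 * γ ^ 2 * δ ^ 2 * (H : ℝ) ^ 3 / (J : ℝ) ^ 2 := by
  have hH' : (H : ℝ) ≠ 0 := by exact_mod_cast hH.ne'
  have hJ : (0 : ℝ) < J := by exact_mod_cast hH.trans_le hHJ
  set μ := (H : ℝ)⁻¹ • ∑ j, lam j with hμ
  set gbar := (H : ℝ)⁻¹ • ∑ j, gradg j μ with hgbar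
  have hstep : 12 * (γ / J) ^ 2 ≤ uf ^ 2 := by
    have h3 : (0 : ℝ) < 2 * √3 := by positivity
    have h1 : γ / J * (2 * √3) ≤ uf := by
      rw [le_div_iff₀ h3] at hγle
      rw [div_mul_eq_mul_div, div_le_iff₀ hJ]
      exact hγle
    have h2 := pow_le_pow_left₀ (by positivity) h1 2
    rw [mul_pow, mul_pow, Real.sq_sqrt (by norm_num)] at h2
    linarith
  have hpoint : ∀ i, ‖lamh i - (μ - (γ * H / J) • gbar)‖ ^ 2 ≤
      3 * ‖lam i - μ‖ ^ 2 + 6 * ((γ * H / J) ^ 2 * δ ^ 2) := by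
    intro i
    have hdecomp : lamh i - (μ - (γ * H / J) • gbar) = (lam i - μ) +
        (γ / J) • (prox i (lam i) - prox i μ) + (-(γ * H / J)) • (gradg i μ - gbar) := by
      rw [hhalf, hθ, hgradg i μ]
      match_scalars <;> field_simp <;> ring
    have hlip : uf * ‖prox i (lam i) - prox i μ‖ ≤ ‖lam i - μ‖ :=
      (hfsc i).mul_norm_sub_le_of_isMin huf.le (Set.subset_univ _) (hCcvx i)
        (hprox i _).1 (hprox i _).1 (hprox i _).2 (hprox i _).2
    have hb : 12 * ‖(γ / J) • (prox i (lam i) - prox i μ)‖ ^ 2 ≤ ‖lam i - μ‖ ^ 2 := by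
      rw [norm_smul, mul_pow, Real.norm_eq_abs, sq_abs, ← mul_assoc]
      calc _ ≤ uf ^ 2 * ‖prox i (lam i) - prox i μ‖ ^ 2 := by gcongr
        _ = (uf * ‖prox i (lam i) - prox i μ‖) ^ 2 := by ring
        _ ≤ _ := by gcongr
    have hc : ‖(-(γ * H / J)) • (gradg i μ - gbar)‖ ^ 2 ≤ (γ * H / J) ^ 2 * δ ^ 2 := by
      rw [norm_smul, mul_pow, Real.norm_eq_abs, sq_abs, neg_sq]
      exact mul_le_mul_of_nonneg_left (hδ μ i) (sq_nonneg _)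
    rw [hdecomp]
    exact (norm_add_add_sq_le_of_norm_sq_le hb).trans (by gcongr)
  calc ∑ i, ‖lamh i - (H : ℝ)⁻¹ • ∑ j, lamh j‖ ^ 2
      ≤ ∑ i, ‖lamh i - (μ - (γ * H / J) • gbar)‖ ^ 2 := by
        simpa using sum_norm_sub_mean_sq_le lamh (μ - (γ * H / J) • gbar)
    _ ≤ ∑ i, (3 * ‖lam i - μ‖ ^ 2 + 6 * ((γ * H / J) ^ 2 * δ ^ 2)) :=
        Finset.sum_le_sum fun i _ ↦ hpoint i
    _ = _ := by
        rw [Finset.sum_add_distrib, ← Finset.mul_sum, Finset.sum_const, Finset.card_univ,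
          Fintype.card_fin, nsmul_eq_mul]
        ring
end

section
/- Let Λ̃^{k} ∈ ℝ^{J×D} stack the dual iterates (λ_i^{k})_{i=1}^{J} generated by the attack-free algorithm from a common initialization λ⁰. If the step sizes satisfy 6(γ^k)²/(u_f²J²) ≤ (2−σ)σ²/(3(3−σ)) and 1 ≤ (γ^k)²/(γ^{k+1})² ≤ 2/(2−σ²) for all k ≥ 0, then for all k ≥ 0: ‖Λ̃^{k+1} − (1/J)11ᵀΛ̃^{k+1}‖_F² ≤ 18(γ^{k+1})²δ̃²J/σ³. -/
open Filter Finset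
open scoped BigOperators Topology InnerProductSpace

/-- Quadratic growth of a strongly convex function, tilted by a linear functional, around a
constrained minimizer. -/
theorem StrongConvexOn.quadratic_growth_of_isMinimizer {E : Type*} [NormedAddCommGroup E]
    [InnerProductSpace ℝ E] {m : ℝ} {f : E → ℝ} {C : Set E} (hf : StrongConvexOn Set.univ m f)
    (hC : Convex ℝ C) {l p q : E} (hp : p ∈ C)
    (hmin : ∀ θ ∈ C, ⟪l, p⟫_ℝ + f p ≤ ⟪l, θ⟫_ℝ + f θ) (hq : q ∈ C) :
    ⟪l, p⟫_ℝ + f p + m / 2 * ‖p - q‖ ^ 2 ≤ ⟪l, q⟫_ℝ + f q := by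
  have key : ∀ t ∈ Set.Ioo (0 : ℝ) 1,
      ⟪l, p⟫_ℝ + f p + (1 - t) * (m / 2 * ‖p - q‖ ^ 2) ≤ ⟪l, q⟫_ℝ + f q := by
    rintro t ⟨h0, h1⟩
    have h2 := hmin _ (hC hp hq (sub_nonneg.2 h1.le) h0.le (by ring))
    have h3 := hf.2 (Set.mem_univ p) (Set.mem_univ q) (sub_nonneg.2 h1.le) h0.le (by ring)
    simp only [inner_add_right, real_inner_smul_right, smul_eq_mul] at h2 h3
    refine le_of_mul_le_mul_left ?_ h0
    linarith
  have hcont : Tendsto (fun t : ℝ => ⟪l, p⟫_ℝ + f p + (1 - t) * (m / 2 * ‖p - q‖ ^ 2))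
      (𝓝[>] 0) (𝓝 (⟪l, p⟫_ℝ + f p + (1 - 0) * (m / 2 * ‖p - q‖ ^ 2))) :=
    ((by fun_prop : Continuous fun t : ℝ =>
      ⟪l, p⟫_ℝ + f p + (1 - t) * (m / 2 * ‖p - q‖ ^ 2)).tendsto 0).mono_left nhdsWithin_le_nhds
  have hle := le_of_tendsto hcont
    (by filter_upwards [Ioo_mem_nhdsGT zero_lt_one] with t ht using key t ht)
  linarith

/-- The constrained minimizer of a strongly convex function is a Lipschitz function of the
linear tilt. -/
theorem StrongConvexOn.norm_minimizer_sub_le {E : Type*} [NormedAddCommGroup E]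
    [InnerProductSpace ℝ E] {m : ℝ} {f : E → ℝ} {C : Set E} (hf : StrongConvexOn Set.univ m f)
    (hC : Convex ℝ C) {l l' p q : E} (hp : p ∈ C) (hq : q ∈ C)
    (hpmin : ∀ θ ∈ C, ⟪l, p⟫_ℝ + f p ≤ ⟪l, θ⟫_ℝ + f θ)
    (hqmin : ∀ θ ∈ C, ⟪l', q⟫_ℝ + f q ≤ ⟪l', θ⟫_ℝ + f θ) :
    m * ‖p - q‖ ≤ ‖l - l'‖ := by
  have h1 := hf.quadratic_growth_of_isMinimizer hC hp hpmin hq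
  have h2 := hf.quadratic_growth_of_isMinimizer hC hq hqmin hp
  rw [norm_sub_rev q p] at h2
  have h3 : ⟪l - l', q - p⟫_ℝ ≤ ‖l - l'‖ * ‖p - q‖ := by
    rw [norm_sub_rev p q]; exact real_inner_le_norm _ _
  simp only [inner_sub_left, inner_sub_right] at h3
  rcases (norm_nonneg (p - q)).eq_or_lt with h | h
  · rw [← h, mul_zero]; exact norm_nonneg _
  · refine le_of_mul_le_mul_right ?_ h
    linarith

/-- A real matrix acts on tuples of Euclidean vectors with Frobenius gain at most its spectral
norm. -/
theorem Matrix.sum_norm_sq_sum_smul_le {m n ι : Type*} [Fintype m] [Fintype n] [DecidableEq n]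
    [Fintype ι] (W : Matrix m n ℝ) (y : n → EuclideanSpace ℝ ι) :
    ∑ i, ‖∑ j, W i j • y j‖ ^ 2 ≤
      ‖LinearMap.toContinuousLinearMap (Matrix.toEuclideanLin W)‖ ^ 2 * ∑ j, ‖y j‖ ^ 2 := by
  simp only [EuclideanSpace.real_norm_sq_eq]
  rw [Finset.sum_comm, Finset.sum_comm (s := (univ : Finset n)), Finset.mul_sum]
  refine Finset.sum_le_sum fun d _ => ?_
  have h := (LinearMap.toContinuousLinearMap (Matrix.toEuclideanLin W)).le_opNorm
    (WithLp.toLp 2 fun j => y j d)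
  have h2 := pow_le_pow_left₀ (norm_nonneg _) h 2
  rw [mul_pow, EuclideanSpace.real_norm_sq_eq, EuclideanSpace.real_norm_sq_eq] at h2
  simpa [Matrix.toLpLin_apply, Matrix.mulVec, dotProduct] using h2

/-- Young's inequality for the squared norm of a difference. -/
theorem norm_sub_sq_le_young {E : Type*} [NormedAddCommGroup E] [InnerProductSpace ℝ E]
    {b : ℝ} (hb : 0 < b) (x y : E) :
    ‖x - y‖ ^ 2 ≤ (1 + b) * ‖x‖ ^ 2 + (1 + b⁻¹) * ‖y‖ ^ 2 := by
  have h1 : ‖x - y‖ ^ 2 ≤ (‖x‖ + ‖y‖) ^ 2 := pow_le_pow_left₀ (norm_nonneg _) (norm_sub_le x y) 2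
  have h2 : 0 ≤ b⁻¹ * (b * ‖x‖ - ‖y‖) ^ 2 := by positivity
  have h3 : b⁻¹ * (b * ‖x‖ - ‖y‖) ^ 2 = b * ‖x‖ ^ 2 - 2 * ‖x‖ * ‖y‖ + b⁻¹ * ‖y‖ ^ 2 := by
    field_simp
    ring
  linarith

theorem statement_11
    (D J : ℕ) (hJ : 1 ≤ J)
    (uf Lf : ℝ) (huf : 0 < uf) (hufLf : uf ≤ Lf)
    (f : Fin J → EuclideanSpace ℝ (Fin D) → ℝ)
    (C : Fin J → Set (EuclideanSpace ℝ (Fin D)))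
    (hCne : ∀ i, (C i).Nonempty)
    (hCcpt : ∀ i, IsCompact (C i))
    (hCcvx : ∀ i, Convex ℝ (C i))
    (hfsc : ∀ i, StrongConvexOn Set.univ uf (f i))
    (hfdiff : ∀ i, Differentiable ℝ (f i))
    (hfsm : ∀ i x y, ‖gradient (f i) x - gradient (f i) y‖ ≤ Lf * ‖x - y‖)
    (s : EuclideanSpace ℝ (Fin D))
    -- `prox i lam` is the minimizer of `θ ↦ ⟪lam, θ⟫ + f i θ` over `C i`
    (prox : Fin J → EuclideanSpace ℝ (Fin D) → EuclideanSpace ℝ (Fin D))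
    (hprox : ∀ i lam, prox i lam ∈ C i ∧
      ∀ θ ∈ C i, ⟪lam, prox i lam⟫_ℝ + f i (prox i lam) ≤ ⟪lam, θ⟫_ℝ + f i θ)
    -- conjugate functions and local dual functions
    (Fstar : Fin J → EuclideanSpace ℝ (Fin D) → ℝ)
    (hFstar : ∀ i lam, Fstar i lam = sSup ((fun θ => ⟪lam, θ⟫_ℝ - f i θ) '' C i))
    (g : Fin J → EuclideanSpace ℝ (Fin D) → ℝ)
    (hgdef : ∀ i lam, g i lam = (J : ℝ)⁻¹ * Fstar i (-lam) + (J : ℝ)⁻¹ * ⟪lam, s⟫_ℝ)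
    -- gradients of the local dual functions
    (gradg : Fin J → EuclideanSpace ℝ (Fin D) → EuclideanSpace ℝ (Fin D))
    (hgradg : ∀ i lam, gradg i lam = (J : ℝ)⁻¹ • s - (J : ℝ)⁻¹ • prox i lam)
    -- uniform bound on the deviation of the local dual gradients
    (δ : ℝ) (hδ0 : 0 ≤ δ)
    (hδ : ∀ (lam : EuclideanSpace ℝ (Fin D)) (i : Fin J),
      ‖gradg i lam - (J : ℝ)⁻¹ • ∑ j, gradg j lam‖ ^ 2 ≤ δ ^ 2)
    -- doubly stochastic mixing matrix with κ˜ < 1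
    (Emix : Matrix (Fin J) (Fin J) ℝ)
    (hEnn : ∀ i j, 0 ≤ Emix i j)
    (hErow : ∀ i, ∑ j, Emix i j = 1)
    (hEcol : ∀ j, ∑ i, Emix i j = 1)
    (κ : ℝ)
    (hκ : κ = ‖LinearMap.toContinuousLinearMap (Matrix.toEuclideanLin
        (Emix - (Matrix.of fun _ _ => (J : ℝ)⁻¹ : Matrix (Fin J) (Fin J) ℝ)))‖ ^ 2)
    (hκlt : κ < 1)
    (σ : ℝ) (hσ : σ = 1 - κ)
    -- step-size conditions
    (γ : ℕ → ℝ) (hγpos : ∀ k, 0 < γ k)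
    (hstep1 : ∀ k, 6 * (γ k) ^ 2 / (uf ^ 2 * (J : ℝ) ^ 2) ≤ (2 - σ) * σ ^ 2 / (3 * (3 - σ)))
    (hstep2 : ∀ k, 1 ≤ (γ k) ^ 2 / (γ (k + 1)) ^ 2 ∧ (γ k) ^ 2 / (γ (k + 1)) ^ 2 ≤ 2 / (2 - σ ^ 2))
    -- the attack-free decentralized resource allocation algorithm
    (lam lamh θv : ℕ → Fin J → EuclideanSpace ℝ (Fin D))
    (lam0 : EuclideanSpace ℝ (Fin D)) (hinit : ∀ i, lam 0 i = lam0)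
    (hθ : ∀ k i, θv k i = prox i (lam k i))
    (hhalf : ∀ k i, lamh k i = lam k i - γ k • ((J : ℝ)⁻¹ • s - (J : ℝ)⁻¹ • θv k i))
    (hnext : ∀ k i, lam (k + 1) i = ∑ j, Emix i j • lamh k j)
    :
    ∀ k : ℕ, ∑ i, ‖lam (k + 1) i - (J : ℝ)⁻¹ • ∑ j, lam (k + 1) j‖ ^ 2 ≤
      18 * (γ (k + 1)) ^ 2 * δ ^ 2 * (J : ℝ) / σ ^ 3 := by
  have hJ' : (0 : ℝ) < J := by exact_mod_cast hJ
  have hJ0 : (J : ℝ) ≠ 0 := hJ'.ne'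
  have hσpos : 0 < σ := by linarith
  have hσ1 : σ ≤ 1 := by
    have : 0 ≤ κ := hκ ▸ sq_nonneg _
    linarith
  have hlip : ∀ i x y, ‖gradg i x - gradg i y‖ ^ 2 ≤ (uf ^ 2 * (J : ℝ) ^ 2)⁻¹ * ‖x - y‖ ^ 2 := by
    intro i x y
    have h1 := (hfsc i).norm_minimizer_sub_le (hCcvx i) (hprox i x).1 (hprox i y).1
      (hprox i x).2 (hprox i y).2
    have h2 : gradg i x - gradg i y = -((J : ℝ)⁻¹ • (prox i x - prox i y)) := by
      rw [hgradg, hgradg, smul_sub]; abel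
    have h3 := pow_le_pow_left₀ (by positivity) h1 2
    rw [h2, norm_neg, norm_smul, norm_inv, Real.norm_natCast, mul_pow]
    calc (J : ℝ)⁻¹ ^ 2 * ‖prox i x - prox i y‖ ^ 2
        = (uf ^ 2 * (J : ℝ) ^ 2)⁻¹ * (uf * ‖prox i x - prox i y‖) ^ 2 := by
          field_simp
      _ ≤ _ := by gcongr
  have hstep : ∀ k, (γ k) ^ 2 * (uf ^ 2 * (J : ℝ) ^ 2)⁻¹ ≤ σ ^ 2 / 25 := by
    intro k
    have h1 := hstep1 k
    have h2 : (2 - σ) * σ ^ 2 / (3 * (3 - σ)) ≤ 6 * (σ ^ 2 / 25) := by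
      rw [div_le_iff₀ (by linarith)]
      nlinarith [sq_nonneg σ, mul_nonneg (sq_nonneg σ) (sub_nonneg.2 hσ1)]
    rw [mul_div_assoc, div_eq_mul_inv] at h1
    linarith
  have hratio : ∀ k, (1 - σ ^ 2 / 2) * (γ k) ^ 2 ≤ (γ (k + 1)) ^ 2 := by
    intro k
    have h1 := (hstep2 k).2
    have h2 : 0 < 2 - σ ^ 2 := by nlinarith
    rw [div_le_div_iff₀ (pow_pos (hγpos _) 2) h2] at h1
    linarith
  set X : ℕ → ℝ := fun k => ∑ i, ‖lam k i - (J : ℝ)⁻¹ • ∑ j, lam k j‖ ^ 2 with hX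
  have hrec : ∀ k, X (k + 1) ≤ (1 - σ) * ((1 + σ / 3) * (1 + σ / 5) ^ 2 * X k +
      (1 + 3 / σ) * ((γ k) ^ 2 * (J * δ ^ 2))) := by
    intro k
    set m := (J : ℝ)⁻¹ • ∑ j, lam k j with hm
    set gm := (J : ℝ)⁻¹ • ∑ j, gradg j m with hgm
    set W : Matrix (Fin J) (Fin J) ℝ := Emix - Matrix.of fun _ _ => (J : ℝ)⁻¹ with hW
    have hWrow : ∀ i, ∑ j, W i j = 0 := by
      intro i
      simp [hW, Finset.sum_sub_distrib, hErow, hJ0]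
    have hdev : ∀ i, lam (k + 1) i - (J : ℝ)⁻¹ • ∑ j, lam (k + 1) j =
        ∑ j, W i j • (lamh k j - (m - γ k • gm)) := by
      intro i
      have h1 : ∑ j, lam (k + 1) j = ∑ j, lamh k j := by
        simp only [hnext]
        rw [Finset.sum_comm]
        simp only [← Finset.sum_smul, hEcol, one_smul]
      rw [h1, hnext]
      simp only [smul_sub (W i _) (lamh k _), Finset.sum_sub_distrib, ← Finset.sum_smul, hWrow,
        zero_smul, sub_zero]
      simp [hW, sub_smul, Finset.sum_sub_distrib, Finset.smul_sum]
    have hy : ∀ j, lamh k j - (m - γ k • gm) =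
        (lam k j - m - γ k • (gradg j (lam k j) - gradg j m)) - γ k • (gradg j m - gm) := by
      intro j
      rw [hhalf, hθ, ← hgradg]
      module
    have hbound : ∀ j, ‖lamh k j - (m - γ k • gm)‖ ^ 2 ≤
        (1 + σ / 3) * (1 + σ / 5) ^ 2 * ‖lam k j - m‖ ^ 2 +
          (1 + 3 / σ) * ((γ k) ^ 2 * δ ^ 2) := by
      intro j
      rw [hy]
      have h1 := norm_sub_sq_le_young (b := σ / 3) (by positivity)
        (lam k j - m - γ k • (gradg j (lam k j) - gradg j m)) (γ k • (gradg j m - gm))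
      have h2 := norm_sub_sq_le_young (b := σ / 5) (by positivity)
        (lam k j - m) (γ k • (gradg j (lam k j) - gradg j m))
      rw [norm_smul (γ k) (gradg j m - gm), mul_pow, Real.norm_eq_abs, sq_abs, inv_div] at h1
      rw [norm_smul (γ k), mul_pow, Real.norm_eq_abs, sq_abs, inv_div] at h2
      have h3 : (γ k) ^ 2 * ‖gradg j (lam k j) - gradg j m‖ ^ 2 ≤
          σ ^ 2 / 25 * ‖lam k j - m‖ ^ 2 := by
        calc _ ≤ (γ k) ^ 2 * ((uf ^ 2 * (J : ℝ) ^ 2)⁻¹ * ‖lam k j - m‖ ^ 2) := by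
              gcongr; exact hlip j _ _
          _ = (γ k) ^ 2 * (uf ^ 2 * (J : ℝ) ^ 2)⁻¹ * ‖lam k j - m‖ ^ 2 := by ring
          _ ≤ _ := by gcongr; exact hstep k
      have h4 : (γ k) ^ 2 * ‖gradg j m - gm‖ ^ 2 ≤ (γ k) ^ 2 * δ ^ 2 := by
        exact mul_le_mul_of_nonneg_left (hδ m j) (sq_nonneg _)
      calc _ ≤ _ := h1
        _ ≤ (1 + σ / 3) * ((1 + σ / 5) * ‖lam k j - m‖ ^ 2 +
              (1 + 5 / σ) * (σ ^ 2 / 25 * ‖lam k j - m‖ ^ 2)) +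
              (1 + 3 / σ) * ((γ k) ^ 2 * δ ^ 2) := by
            gcongr
            exact h2.trans (by gcongr)
        _ = _ := by
            field_simp
            ring
    calc X (k + 1) = ∑ i, ‖∑ j, W i j • (lamh k j - (m - γ k • gm))‖ ^ 2 := by
          simp only [hX, hdev]
      _ ≤ κ * ∑ j, ‖lamh k j - (m - γ k • gm)‖ ^ 2 := hκ ▸ W.sum_norm_sq_sum_smul_le _
      _ ≤ (1 - σ) * ∑ j, ((1 + σ / 3) * (1 + σ / 5) ^ 2 * ‖lam k j - m‖ ^ 2 +
          (1 + 3 / σ) * ((γ k) ^ 2 * δ ^ 2)) := by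
          rw [show κ = 1 - σ by linarith]
          exact mul_le_mul_of_nonneg_left (Finset.sum_le_sum fun j _ => hbound j) (by linarith)
      _ = _ := by
          rw [Finset.sum_add_distrib, ← Finset.mul_sum, Finset.sum_const, card_univ,
            Fintype.card_fin, nsmul_eq_mul]
          ring
  have hcoef : (1 - σ) * ((1 + σ / 3) * (1 + σ / 5) ^ 2 * 18 + (1 + 3 / σ) * σ ^ 3) ≤
      18 * (1 - σ ^ 2 / 2) := by
    have h1 : (1 + 3 / σ) * σ ^ 3 = σ ^ 3 + 3 * σ ^ 2 := by
      field_simp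
    rw [h1]
    have h2 : σ ^ 2 ≤ σ := by nlinarith
    have h3 : 0 ≤ σ ^ 3 := by positivity
    have h4 : 0 ≤ σ ^ 4 := by positivity
    nlinarith
  have hmain : ∀ k, X k ≤ 18 * (γ k) ^ 2 * δ ^ 2 * (J : ℝ) / σ ^ 3 := by
    intro k
    induction k with
    | zero =>
      have : X 0 = 0 := by
        simp [hX, hinit, ← Nat.cast_smul_eq_nsmul ℝ, smul_smul, hJ0]
      rw [this]
      positivity
    | succ k ih =>
      calc X (k + 1) ≤ _ := hrec k
        _ ≤ (1 - σ) * ((1 + σ / 3) * (1 + σ / 5) ^ 2 *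
              (18 * (γ k) ^ 2 * δ ^ 2 * (J : ℝ) / σ ^ 3) +
              (1 + 3 / σ) * ((γ k) ^ 2 * (J * δ ^ 2))) := by
            refine mul_le_mul_of_nonneg_left ?_ (by linarith)
            gcongr
        _ = (1 - σ) * ((1 + σ / 3) * (1 + σ / 5) ^ 2 * 18 + (1 + 3 / σ) * σ ^ 3) *
              ((γ k) ^ 2 * δ ^ 2 * J / σ ^ 3) := by
            field_simp
        _ ≤ 18 * (1 - σ ^ 2 / 2) * ((γ k) ^ 2 * δ ^ 2 * J / σ ^ 3) := by
            gcongr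
        _ = 18 * ((1 - σ ^ 2 / 2) * (γ k) ^ 2) * δ ^ 2 * J / σ ^ 3 := by ring
        _ ≤ _ := by
            gcongr
            exact hratio k
  exact fun k => hmain (k + 1)
end
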